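/- (Matrix Krivine–Stengle Positivstellensatz) Let G(x) be a q×q symmetric matrix with entries in ℝ[x_1,...,x_n], K = {x ∈ ℝ^n : G(x) ⪰ 0}, G̃(x) = diag(G(x), I_q − G(x)) the 2q×2q block-diagonal dilation, and let H(G) ⊆ ℝ[x_1,...,x_n] be the set of all polynomials of the form λ_0 + Σ_{k=1}^m ⟨Λ_k, G̃(x)^{⊗k}⟩ where m ∈ ℕ, λ_0 ≥ 0 is real, and each Λ_k is a (2q)^k × (2q)^k positive semidefinite real matrix. Suppose (i) K is compact and I_q − G(x) ⪰ 0 for all x ∈ K, and (ii) ℝ[x_1,...,x_n] = H(G) − H(G). If f ∈ ℝ[x_1,...,x_n] satisfies f(x) > 0 for all x ∈ K, then f ∈ H(G). -/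

import Mathlib

open scoped BigOperators

noncomputable section

/-- The `k`-fold Kronecker power of a matrix, with rows and columns indexed by
functions `Fin k → ι` (a type of cardinality `(#ι)^k`):
`(M^{⊗k})_{a,b} = ∏ᵢ M_{a i, b i}`. -/
def kronPow {ι : Type*} {R : Type*} [CommMonoid R] (M : Matrix ι ι R) (k : ℕ) :
    Matrix (Fin k → ι) (Fin k → ι) R :=
  Matrix.of fun a b => ∏ i, M (a i) (b i)

/-- Trace inner product `⟨Λ, B⟩ = tr(Λᵀ B) = ∑ᵢⱼ Λᵢⱼ Bᵢⱼ` of a real matrix against a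
polynomial matrix. -/
def tipP {n : ℕ} {ι : Type*} [Fintype ι] (Λ : Matrix ι ι ℝ)
    (B : Matrix ι ι (MvPolynomial (Fin n) ℝ)) : MvPolynomial (Fin n) ℝ :=
  ∑ i, ∑ j, MvPolynomial.C (Λ i j) * B i j

/-- The cone `H(G)` of all polynomials of the form
`λ₀ + ∑_{k=1}^m ⟨Λ_k, G(x)^{⊗k}⟩` with `λ₀ ≥ 0` and each `Λ_k` positive semidefinite. -/
def Hset {n : ℕ} {ι : Type*} [Fintype ι]
    (G : Matrix ι ι (MvPolynomial (Fin n) ℝ)) : Set (MvPolynomial (Fin n) ℝ) :=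
  { p | ∃ (m : ℕ) (lam0 : ℝ) (Λ : (k : ℕ) → Matrix (Fin k → ι) (Fin k → ι) ℝ),
      0 ≤ lam0 ∧ (∀ k ∈ Finset.Icc 1 m, (Λ k).PosSemidef) ∧
      p = MvPolynomial.C lam0 + ∑ k ∈ Finset.Icc 1 m, tipP (Λ k) (kronPow G k) }

/-- Entrywise evaluation of a polynomial matrix at a point `x`. -/
def evalMat {n : ℕ} {ι : Type*} (x : Fin n → ℝ)
    (B : Matrix ι ι (MvPolynomial (Fin n) ℝ)) : Matrix ι ι ℝ :=
  Matrix.of fun i j => MvPolynomial.eval x (B i j)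

/-- The dilated matrix `G̃(x) = diag(G(x), I_q − G(x))`, a `2q × 2q` block diagonal
polynomial matrix. -/
def dilate {n q : ℕ} (G : Matrix (Fin q) (Fin q) (MvPolynomial (Fin n) ℝ)) :
    Matrix (Fin q ⊕ Fin q) (Fin q ⊕ Fin q) (MvPolynomial (Fin n) ℝ) :=
  Matrix.fromBlocks G 0 0 (1 - G)

/-- The state space of a subsemiring `H` of a real algebra: the unital linear functionals that are
nonnegative on `H`, viewed inside the product space `A → ℝ`. -/
def stateSpace {A : Type*} [CommRing A] [Algebra ℝ A] (H : Subsemiring A) : Set (A → ℝ) :=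
  { φ | (∀ a b, φ (a + b) = φ a + φ b) ∧ (∀ (r : ℝ) a, φ (r • a) = r * φ a) ∧ φ 1 = 1 ∧
    ∀ h ∈ H, 0 ≤ φ h }

section Representation

variable {A : Type*} [CommRing A] [Algebra ℝ A] {H : Subsemiring A}

lemma smul_mem_of_nonneg (hreal : ∀ r : ℝ, 0 ≤ r → algebraMap ℝ A r ∈ H) {r : ℝ} (hr : 0 ≤ r)
    {a : A} (ha : a ∈ H) : r • a ∈ H := by
  rw [Algebra.smul_def]
  exact H.mul_mem (hreal r hr) ha

lemma le_of_algebraMap_sub_mem {φ : A → ℝ} (hφ : φ ∈ stateSpace H) {N : ℝ} {a : A}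
    (h : algebraMap ℝ A N - a ∈ H) : φ a ≤ N := by
  obtain ⟨hadd, hsmul, hone, hpos⟩ := hφ
  have h1 := hpos _ h
  have h2 : φ (algebraMap ℝ A N) = N := by
    rw [Algebra.algebraMap_eq_smul_one, hsmul, hone, mul_one]
  have h3 := hadd (algebraMap ℝ A N - a) a
  rw [sub_add_cancel, h2] at h3
  linarith

lemma isCompact_stateSpace (harch : ∀ a : A, ∃ N : ℝ, algebraMap ℝ A N - a ∈ H) :
    IsCompact (stateSpace H) := by
  choose N hN using harch
  refine IsCompact.of_isClosed_subset
    (isCompact_univ_pi fun a : A => isCompact_Icc (a := -N (-a)) (b := N a)) ?_ ?_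
  · have e : stateSpace H = (⋂ a, ⋂ b, {φ : A → ℝ | φ (a + b) = φ a + φ b}) ∩
        ((⋂ r : ℝ, ⋂ a, {φ : A → ℝ | φ (r • a) = r * φ a}) ∩
        ({φ : A → ℝ | φ 1 = 1} ∩ ⋂ h ∈ H, {φ : A → ℝ | 0 ≤ φ h})) := by
      ext φ
      simp [stateSpace]
    rw [e]
    refine IsClosed.inter ?_ (IsClosed.inter ?_ (IsClosed.inter ?_ ?_))
    · exact isClosed_iInter fun a => isClosed_iInter fun b =>
        isClosed_eq (by fun_prop) (by fun_prop)
    · exact isClosed_iInter fun r => isClosed_iInter fun a =>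
        isClosed_eq (by fun_prop) (by fun_prop)
    · exact isClosed_eq (by fun_prop) (by fun_prop)
    · exact isClosed_biInter fun h _ => isClosed_le (by fun_prop) (by fun_prop)
  · intro φ hφ a _
    refine ⟨?_, le_of_algebraMap_sub_mem hφ (hN a)⟩
    have h1 := le_of_algebraMap_sub_mem hφ (hN (-a))
    have h2 : φ (-a) = -φ a := by
      have := hφ.2.1 (-1) a
      simpa using this
    linarith

/-- A functional separating a point from an archimedean subsemiring. -/
lemma exists_mem_stateSpace_nonpos (hreal : ∀ r : ℝ, 0 ≤ r → algebraMap ℝ A r ∈ H)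
    (harch : ∀ a : A, ∃ N : ℝ, algebraMap ℝ A N - a ∈ H) {f : A} (hf : f ∉ H) :
    ∃ φ ∈ stateSpace H, φ f ≤ 0 := by
  have key : ∀ r : ℝ, r < 0 → ∀ h ∈ H, ∀ c : ℝ, 0 ≤ c → algebraMap ℝ A r ≠ h - c • f := by
    intro r hr h hh c hc e
    apply hf
    rcases hc.eq_or_lt with rfl | hc
    · have hrH : algebraMap ℝ A r ∈ H := by rw [e]; simpa using hh
      obtain ⟨N, hN⟩ := harch (-f)
      have h1 : algebraMap ℝ A (|N| / (-r)) ∈ H := hreal _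
        (div_nonneg (abs_nonneg N) (by linarith))
      have h2 := H.mul_mem h1 hrH
      have h3 := H.add_mem (H.add_mem hN h2) (hreal (|N| - N) (by linarith [le_abs_self N]))
      convert h3 using 1
      rw [← map_mul, show |N| / (-r) * r = -|N| by field_simp [hr.ne], map_neg, map_sub]
      ring
    · have h1 : c • f = h + algebraMap ℝ A (-r) := by
        rw [map_neg, e]; abel
      have h2 : f = c⁻¹ • (h + algebraMap ℝ A (-r)) := by
        rw [← h1, smul_smul, inv_mul_cancel₀ hc.ne', one_smul]
      rw [h2]
      exact smul_mem_of_nonneg hreal (by positivity) (H.add_mem hh (hreal _ (by linarith)))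
  have hone : (1 : A) ≠ 0 := by
    intro h10
    apply hf
    have : f = 0 := by rw [← mul_one f, h10, mul_zero]
    rw [this]
    exact H.zero_mem
  let s : PointedCone ℝ A :=
    { carrier := {a | ∃ h ∈ H, ∃ c : ℝ, 0 ≤ c ∧ a = h - c • f}
      add_mem' := by
        rintro _ _ ⟨h, hh, c, hc, rfl⟩ ⟨h', hh', c', hc', rfl⟩
        exact ⟨h + h', H.add_mem hh hh', c + c', by positivity, by rw [add_smul]; abel⟩
      zero_mem' := ⟨0, H.zero_mem, 0, le_rfl, by simp⟩
      smul_mem' := by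
        rintro ⟨r, hr⟩ _ ⟨h, hh, c, hc, rfl⟩
        refine ⟨r • h, smul_mem_of_nonneg hreal hr hh, r * c, by positivity, ?_⟩
        change r • (h - c • f) = _
        rw [smul_sub, smul_smul] }
  have hs : ∀ a, a ∈ s ↔ ∃ h ∈ H, ∃ c : ℝ, 0 ≤ c ∧ a = h - c • f := fun a => Iff.rfl
  obtain ⟨g, hg1, hg2⟩ := riesz_extension s
    (LinearPMap.mkSpanSingleton (σ := RingHom.id ℝ) (1 : A) (1 : ℝ) hone)
    (by
      rintro ⟨x, hx⟩ hxs
      obtain ⟨r, rfl⟩ := Submodule.mem_span_singleton.1 hx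
      have : (LinearPMap.mkSpanSingleton (σ := RingHom.id ℝ) (1 : A) (1 : ℝ) hone) ⟨r • 1, hx⟩ =
          r :=
        (LinearPMap.mkSpanSingleton'_apply _ _ _ r hx).trans (by simp)
      rw [this]
      by_contra! hr
      obtain ⟨h, hh, c, hc, e⟩ := (hs _).1 hxs
      exact key r hr h hh c hc (by rw [← e, Algebra.algebraMap_eq_smul_one]))
    (by
      intro y
      obtain ⟨N, hN⟩ := harch (-y)
      refine ⟨⟨N • 1, Submodule.smul_mem _ _ (Submodule.mem_span_singleton_self _)⟩, ?_⟩
      refine (hs _).2 ⟨_, hN, 0, le_rfl, ?_⟩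
      simp [Algebra.algebraMap_eq_smul_one])
  refine ⟨g, ⟨map_add g, fun r a => by simp, ?_, fun h hh => hg2 h ⟨h, hh, 0, le_rfl, by simp⟩⟩, ?_⟩
  · exact (hg1 ⟨1, Submodule.mem_span_singleton_self _⟩).trans
      (LinearPMap.mkSpanSingleton_apply ℝ ℝ hone 1)
  · have := hg2 (-f) ⟨0, H.zero_mem, 1, zero_le_one, by simp⟩
    rw [map_neg] at this
    linarith

/-- Extreme points of the state space are multiplicative. -/
lemma map_mul_of_mem_extremePoints (harch : ∀ a : A, ∃ N : ℝ, algebraMap ℝ A N - a ∈ H)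
    {φ : A → ℝ} (hφ : φ ∈ Set.extremePoints ℝ (stateSpace H)) {h : A} (hh : h ∈ H) (g : A) :
    φ (h * g) = φ h * φ g := by
  obtain ⟨hφS, hext⟩ := mem_extremePoints.1 hφ
  obtain ⟨hadd, hsmul, hone, hpos⟩ := id hφS
  have hneg : ∀ a, φ (-a) = -φ a := fun a => by simpa using hsmul (-1) a
  have hsub : ∀ a b, φ (a - b) = φ a - φ b := fun a b => by
    rw [sub_eq_add_neg, hadd, hneg, sub_eq_add_neg]
  obtain ⟨N, hN⟩ := harch h
  have hle : φ h ≤ N := le_of_algebraMap_sub_mem hφS hN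
  rcases (hpos h hh).eq_or_lt with h0 | h0
  · have aux : ∀ g, φ (h * g) ≤ 0 := by
      intro g
      obtain ⟨M, hM⟩ := harch g
      have := hpos _ (H.mul_mem hh hM)
      rw [mul_sub, hsub, mul_comm, ← Algebra.smul_def, hsmul, ← h0] at this
      linarith
    have h1 := aux g
    have h2 := aux (-g)
    rw [mul_neg, hneg] at h2
    rw [← h0]
    linarith
  · have state : ∀ u ∈ H, 0 < φ u → (fun a => φ (u * a) / φ u) ∈ stateSpace H := by
      intro u hu hu0
      refine ⟨fun a b => ?_, fun r a => ?_, ?_, fun a ha => ?_⟩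
      · simp only [mul_add, hadd, add_div]
      · simp only [mul_smul_comm, hsmul, mul_div_assoc]
      · simp only [mul_one, div_self hu0.ne']
      · exact div_nonneg (hpos _ (H.mul_mem hu ha)) hu0.le
    have hv : algebraMap ℝ A N - h + 1 ∈ H := H.add_mem hN H.one_mem
    have hval : ∀ a, φ ((algebraMap ℝ A N - h + 1) * a) = (N + 1) * φ a - φ (h * a) := by
      intro a
      rw [add_mul, sub_mul, hadd, hsub, ← Algebra.smul_def, hsmul, one_mul]
      ring
    have hv1 : φ (algebraMap ℝ A N - h + 1) = N + 1 - φ h := by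
      simpa [hone] using hval 1
    have hv0 : 0 < φ (algebraMap ℝ A N - h + 1) := by rw [hv1]; linarith
    have hN1 : 0 < N + 1 := by linarith
    have := (hext _ (state h hh h0) _ (state _ hv hv0) ?_).1
    · have := congrFun this g
      field_simp at this
      linarith
    · refine ⟨φ h / (N + 1), (N + 1 - φ h) / (N + 1), by positivity,
        div_pos (by linarith) hN1, by field_simp; ring, ?_⟩
      funext a
      have h1 : N + 1 - φ h ≠ 0 := by linarith
      simp only [Pi.add_apply, Pi.smul_apply, smul_eq_mul, hval, hv1]
      field_simp
      ring

/-- **Kadison–Dubois representation theorem**: an element outside an archimedean subsemiring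
containing the nonnegative reals is nonpositive at some real character that is nonnegative on the
subsemiring. -/
theorem exists_algHom_nonpos_of_notMem (hreal : ∀ r : ℝ, 0 ≤ r → algebraMap ℝ A r ∈ H)
    (harch : ∀ a : A, ∃ N : ℝ, algebraMap ℝ A N - a ∈ H) {f : A} (hf : f ∉ H) :
    ∃ φ : A →ₐ[ℝ] ℝ, (∀ h ∈ H, 0 ≤ φ h) ∧ φ f ≤ 0 := by
  obtain ⟨φ₀, hφ₀, hφ₀f⟩ := exists_mem_stateSpace_nonpos hreal harch hf
  have hcomp := isCompact_stateSpace harch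
  have hcont : Continuous fun φ : A → ℝ => φ f := continuous_apply f
  obtain ⟨φ₁, hφ₁, hmin⟩ := hcomp.exists_isMinOn ⟨φ₀, hφ₀⟩ hcont.continuousOn
  have hmin' : ∀ ψ ∈ stateSpace H, φ₁ f ≤ ψ f := fun ψ hψ => hmin hψ
  have hface : IsCompact (stateSpace H ∩ {φ : A → ℝ | φ f = φ₁ f}) :=
    hcomp.inter_right (isClosed_eq hcont continuous_const)
  obtain ⟨φ, hφ⟩ := hface.extremePoints_nonempty ⟨φ₁, hφ₁, rfl⟩
  obtain ⟨⟨hφS, hφf⟩, hext⟩ := mem_extremePoints.1 hφ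
  have hφext : φ ∈ Set.extremePoints ℝ (stateSpace H) := by
    refine mem_extremePoints.2 ⟨hφS, fun ψ₁ h₁ ψ₂ h₂ hseg => ?_⟩
    obtain ⟨s, t, hs, ht, hst, e⟩ := id hseg
    have e' : s * ψ₁ f + t * ψ₂ f = φ₁ f := by
      rw [← show φ f = φ₁ f from hφf, ← e]
      simp
    have m₁ := hmin' _ h₁
    have m₂ := hmin' _ h₂
    obtain rfl : s = 1 - t := by linarith
    refine hext _ ⟨h₁, ?_⟩ _ ⟨h₂, ?_⟩ hseg
    · change ψ₁ f = φ₁ f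
      refine le_antisymm ?_ m₁
      by_contra! hlt
      nlinarith [mul_lt_mul_of_pos_left hlt hs, mul_le_mul_of_nonneg_left m₂ ht.le]
    · change ψ₂ f = φ₁ f
      refine le_antisymm ?_ m₂
      by_contra! hlt
      nlinarith [mul_lt_mul_of_pos_left hlt ht, mul_le_mul_of_nonneg_left m₁ hs.le]
  have hmul : ∀ a b, φ (a * b) = φ a * φ b := by
    intro a b
    obtain ⟨N, hN⟩ := harch (-a)
    have h1 : algebraMap ℝ A N - -a + algebraMap ℝ A (|N| - N) = algebraMap ℝ A |N| + a := by
      rw [map_sub]; ring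
    have h2 := H.add_mem hN (hreal (|N| - N) (by linarith [le_abs_self N]))
    rw [h1] at h2
    have h3 := map_mul_of_mem_extremePoints harch hφext h2 b
    have h4 : φ (algebraMap ℝ A |N|) = |N| := by
      rw [Algebra.algebraMap_eq_smul_one, hφS.2.1, hφS.2.2.1, mul_one]
    rw [add_mul, hφS.1, hφS.1, ← Algebra.smul_def, hφS.2.1, h4] at h3
    linarith
  let L : A →ₗ[ℝ] ℝ :=
    { toFun := φ
      map_add' := hφS.1
      map_smul' := hφS.2.1 }
  refine ⟨AlgHom.ofLinearMap L hφS.2.2.1 hmul, hφS.2.2.2, ?_⟩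
  change φ f ≤ 0
  rw [show φ f = φ₁ f from hφf]
  exact (hmin' _ hφ₀).trans hφ₀f

end Representation

section Cone

variable {n : ℕ} {ι : Type*} [Fintype ι] {G : Matrix ι ι (MvPolynomial (Fin n) ℝ)}

lemma tipP_add {κ : Type*} [Fintype κ] (Λ Λ' : Matrix κ κ ℝ)
    (B : Matrix κ κ (MvPolynomial (Fin n) ℝ)) :
    tipP (Λ + Λ') B = tipP Λ B + tipP Λ' B := by
  simp [tipP, add_mul, Finset.sum_add_distrib]

lemma tipP_smul {κ : Type*} [Fintype κ] (c : ℝ) (Λ : Matrix κ κ ℝ)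
    (B : Matrix κ κ (MvPolynomial (Fin n) ℝ)) :
    tipP (c • Λ) B = MvPolynomial.C c * tipP Λ B := by
  simp [tipP, Finset.mul_sum, mul_assoc]

lemma tipP_zero {κ : Type*} [Fintype κ] (B : Matrix κ κ (MvPolynomial (Fin n) ℝ)) :
    tipP 0 B = 0 := by
  simp [tipP]

lemma tipP_one_kronPow [DecidableEq ι] (k : ℕ) : tipP 1 (kronPow G k) = G.trace ^ k := by
  simp [tipP, Matrix.one_apply, Matrix.trace, Fintype.sum_pow, kronPow]

lemma tipP_mul_tipP (k l : ℕ) (Λ : Matrix (Fin k → ι) (Fin k → ι) ℝ)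
    (Λ' : Matrix (Fin l → ι) (Fin l → ι) ℝ) :
    tipP Λ (kronPow G k) * tipP Λ' (kronPow G l) =
      tipP ((Matrix.kronecker Λ Λ').submatrix (Fin.appendEquiv k l).symm
        (Fin.appendEquiv k l).symm) (kronPow G (k + l)) := by
  have happ : ∀ a b : (Fin k → ι) × (Fin l → ι),
      kronPow G (k + l) (Fin.appendEquiv k l a) (Fin.appendEquiv k l b) =
        kronPow G k a.1 b.1 * kronPow G l a.2 b.2 := by
    intro a b
    simp [kronPow, Fin.prod_univ_add, Fin.appendEquiv]
  simp only [tipP]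
  rw [← (Fin.appendEquiv k l).sum_comp]
  simp_rw [← (Fin.appendEquiv k l).sum_comp (fun j => _ * kronPow G (k + l) _ j), happ,
    Matrix.submatrix_apply, Equiv.symm_apply_apply]
  rw [Fintype.sum_prod_type, Finset.sum_mul_sum]
  refine Finset.sum_congr rfl fun i _ => Finset.sum_congr rfl fun j _ => ?_
  rw [Fintype.sum_prod_type, Finset.sum_mul_sum]
  refine Finset.sum_congr rfl fun i' _ => Finset.sum_congr rfl fun j' _ => ?_
  simp only [Matrix.kronecker, Matrix.kroneckerMap_apply, map_mul]
  ring

lemma exists_smul_one_sub_posSemidef {κ : Type*} [Fintype κ] [DecidableEq κ] {Λ : Matrix κ κ ℝ}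
    (hΛ : Λ.IsHermitian) : ∃ c : ℝ, 0 ≤ c ∧ (c • (1 : Matrix κ κ ℝ) - Λ).PosSemidef := by
  refine ⟨∑ i, ∑ j, |Λ i j|, by positivity, Matrix.PosSemidef.of_dotProduct_mulVec_nonneg
    (Matrix.IsHermitian.sub (by simp [Matrix.IsHermitian]) hΛ) fun x => ?_⟩
  rw [Matrix.sub_mulVec, Matrix.smul_mulVec, Matrix.one_mulVec, dotProduct_sub, sub_nonneg,
    dotProduct_smul, smul_eq_mul, star_trivial]
  simp only [dotProduct, Matrix.mulVec, Finset.sum_mul (s := Finset.univ)]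
  refine Finset.sum_le_sum fun i _ => ?_
  rw [Finset.mul_sum]
  refine Finset.sum_le_sum fun j _ => ?_
  have hx : ∀ k, x k ^ 2 ≤ ∑ l, x l * x l := fun k => by
    rw [pow_two]
    exact Finset.single_le_sum (f := fun l => x l * x l) (fun l _ => mul_self_nonneg _)
      (Finset.mem_univ k)
  have hij : |x i * x j| ≤ ∑ l, x l * x l := by
    rw [abs_le]
    constructor <;> nlinarith [hx i, hx j, sq_nonneg (x i + x j), sq_nonneg (x i - x j)]
  calc x i * (Λ i j * x j) = Λ i j * (x i * x j) := by ring
    _ ≤ |Λ i j * (x i * x j)| := le_abs_self _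
    _ = |Λ i j| * |x i * x j| := abs_mul _ _
    _ ≤ |Λ i j| * ∑ l, x l * x l := by gcongr

lemma C_mem_Hset {c : ℝ} (hc : 0 ≤ c) : MvPolynomial.C c ∈ Hset G :=
  ⟨0, c, fun _ => 0, hc, by simp, by simp⟩

lemma tipP_mem_Hset {k : ℕ} (hk : 1 ≤ k) {Λ : Matrix (Fin k → ι) (Fin k → ι) ℝ}
    (hΛ : Λ.PosSemidef) : tipP Λ (kronPow G k) ∈ Hset G := by
  classical
  refine ⟨k, 0, Function.update (fun _ => 0) k Λ, le_rfl, fun l _ => ?_, ?_⟩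
  · by_cases h : l = k
    · subst h
      simpa using hΛ
    · rw [Function.update_of_ne h]
      exact Matrix.PosSemidef.zero
  · rw [Finset.sum_eq_single k]
    · simp
    · intro l _ h
      rw [Function.update_of_ne h, tipP_zero]
    · intro h
      simp [hk] at h

lemma sum_tipP_ite {m M : ℕ} (h : m ≤ M) (Λ : (k : ℕ) → Matrix (Fin k → ι) (Fin k → ι) ℝ) :
    ∑ k ∈ Finset.Icc 1 M, tipP (if k ≤ m then Λ k else 0) (kronPow G k) =
      ∑ k ∈ Finset.Icc 1 m, tipP (Λ k) (kronPow G k) := by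
  symm
  refine Finset.sum_subset_zero_on_sdiff (Finset.Icc_subset_Icc_right h) ?_ ?_
  · intro k hk
    simp only [Finset.mem_sdiff, Finset.mem_Icc] at hk
    rw [if_neg (by omega), tipP_zero]
  · intro k hk
    rw [if_pos (Finset.mem_Icc.1 hk).2]

lemma add_mem_Hset {p p' : MvPolynomial (Fin n) ℝ} (hp : p ∈ Hset G) (hp' : p' ∈ Hset G) :
    p + p' ∈ Hset G := by
  obtain ⟨m, c, Λ, hc, hΛ, rfl⟩ := hp
  obtain ⟨m', c', Λ', hc', hΛ', rfl⟩ := hp'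
  refine ⟨max m m', c + c',
    fun k => (if k ≤ m then Λ k else 0) + (if k ≤ m' then Λ' k else 0), by positivity, ?_, ?_⟩
  · intro k hk
    rw [Finset.mem_Icc] at hk
    refine Matrix.PosSemidef.add ?_ ?_
    · split_ifs with h
      · exact hΛ k (Finset.mem_Icc.2 ⟨hk.1, h⟩)
      · exact Matrix.PosSemidef.zero
    · split_ifs with h
      · exact hΛ' k (Finset.mem_Icc.2 ⟨hk.1, h⟩)
      · exact Matrix.PosSemidef.zero
  · simp_rw [tipP_add, Finset.sum_add_distrib]
    rw [sum_tipP_ite (le_max_left _ _), sum_tipP_ite (le_max_right _ _), map_add]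
    ring

lemma Hset_induction {P : MvPolynomial (Fin n) ℝ → Prop}
    (hC : ∀ c : ℝ, 0 ≤ c → P (MvPolynomial.C c))
    (htip : ∀ (k : ℕ) (Λ : Matrix (Fin k → ι) (Fin k → ι) ℝ), 1 ≤ k → Λ.PosSemidef →
      P (tipP Λ (kronPow G k)))
    (hadd : ∀ p p', P p → P p' → P (p + p')) {p : MvPolynomial (Fin n) ℝ} (hp : p ∈ Hset G) :
    P p := by
  obtain ⟨m, c, Λ, hc, hΛ, rfl⟩ := hp
  refine hadd _ _ (hC c hc) (Finset.sum_induction _ P hadd ?_ fun k hk =>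
    htip k _ (Finset.mem_Icc.1 hk).1 (hΛ k hk))
  simpa using hC 0 le_rfl

lemma mul_mem_Hset {p p' : MvPolynomial (Fin n) ℝ} (hp : p ∈ Hset G) (hp' : p' ∈ Hset G) :
    p * p' ∈ Hset G := by
  have hCmul : ∀ c : ℝ, 0 ≤ c → ∀ p ∈ Hset G, MvPolynomial.C c * p ∈ Hset G := by
    intro c hc p hp
    refine Hset_induction (P := fun p => MvPolynomial.C c * p ∈ Hset G) (fun c' hc' => ?_)
      (fun k Λ hk hΛ => ?_) (fun p p' h h' => ?_) hp
    · rw [← map_mul]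
      exact C_mem_Hset (by positivity)
    · rw [← tipP_smul]
      exact tipP_mem_Hset hk (hΛ.smul hc)
    · rw [mul_add]
      exact add_mem_Hset h h'
  refine Hset_induction (P := fun p => p * p' ∈ Hset G) (fun c hc => hCmul c hc p' hp')
    (fun k Λ hk hΛ => ?_) (fun p₁ p₂ h₁ h₂ => ?_) hp
  · refine Hset_induction (P := fun p' => tipP Λ (kronPow G k) * p' ∈ Hset G)
      (fun c hc => ?_) (fun l Λ' hl hΛ' => ?_) (fun p₁ p₂ h₁ h₂ => ?_) hp'
    · rw [mul_comm]
      exact hCmul c hc _ (tipP_mem_Hset hk hΛ)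
    · rw [tipP_mul_tipP]
      exact tipP_mem_Hset (by omega) ((hΛ.kronecker hΛ').submatrix _)
    · rw [mul_add]
      exact add_mem_Hset h₁ h₂
  · rw [add_mul]
    exact add_mem_Hset h₁ h₂

variable (G) in
/-- The cone `Hset G` as a subsemiring of the polynomial ring. -/
def HsetSubsemiring : Subsemiring (MvPolynomial (Fin n) ℝ) where
  carrier := Hset G
  mul_mem' := mul_mem_Hset
  one_mem' := by simpa using C_mem_Hset (G := G) zero_le_one
  add_mem' := add_mem_Hset
  zero_mem' := by simpa using C_mem_Hset (G := G) le_rfl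

lemma exists_C_sub_mem_Hset {t : ℝ} (ht : G.trace = MvPolynomial.C t)
    {p : MvPolynomial (Fin n) ℝ} (hp : p ∈ Hset G) :
    ∃ N : ℝ, MvPolynomial.C N - p ∈ Hset G := by
  classical
  refine Hset_induction (P := fun p => ∃ N : ℝ, MvPolynomial.C N - p ∈ Hset G)
    (fun c _ => ⟨c, ?_⟩) (fun k Λ hk hΛ => ?_) (fun p p' h h' => ?_) hp
  · simpa using C_mem_Hset (G := G) le_rfl
  · obtain ⟨c, _, hcΛ⟩ := exists_smul_one_sub_posSemidef hΛ.isHermitian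
    refine ⟨c * t ^ k, ?_⟩
    have h1 : tipP (c • (1 : Matrix (Fin k → ι) (Fin k → ι) ℝ) - Λ) (kronPow G k) +
        tipP Λ (kronPow G k) = MvPolynomial.C (c * t ^ k) := by
      rw [← tipP_add, sub_add_cancel, tipP_smul, tipP_one_kronPow, ht, map_mul, map_pow]
    rw [← h1, add_sub_cancel_right]
    exact tipP_mem_Hset hk hcΛ
  · obtain ⟨N, hN⟩ := h
    obtain ⟨N', hN'⟩ := h'
    refine ⟨N + N', ?_⟩
    rw [map_add, add_sub_add_comm]
    exact add_mem_Hset hN hN'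

lemma trace_dilate {q : ℕ} (G : Matrix (Fin q) (Fin q) (MvPolynomial (Fin n) ℝ)) :
    (dilate G).trace = MvPolynomial.C (q : ℝ) := by
  simp [dilate, Matrix.trace, Fintype.sum_sum_type]

lemma eval_tipP {κ : Type*} [Fintype κ] (Λ : Matrix κ κ ℝ)
    (B : Matrix κ κ (MvPolynomial (Fin n) ℝ)) (x : Fin n → ℝ) :
    MvPolynomial.eval x (tipP Λ B) = ∑ i, ∑ j, Λ i j * evalMat x B i j := by
  simp [tipP, evalMat]

lemma posSemidef_evalMat_of_nonneg (hG : G.IsSymm) {x : Fin n → ℝ}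
    (h : ∀ p ∈ Hset G, 0 ≤ MvPolynomial.eval x p) : (evalMat x G).PosSemidef := by
  refine Matrix.PosSemidef.of_dotProduct_mulVec_nonneg ?_ fun v => ?_
  · ext i j
    simp [evalMat, hG.apply i j]
  · have h1 := h _ (tipP_mem_Hset (G := G) le_rfl
      ((Matrix.posSemidef_vecMulVec_self_star v).submatrix (Equiv.funUnique (Fin 1) ι)))
    rw [eval_tipP] at h1
    refine h1.trans_eq (Eq.symm ?_)
    simp only [dotProduct, Matrix.mulVec, Finset.mul_sum]
    refine Fintype.sum_equiv (Equiv.funUnique (Fin 1) ι).symm _ _ fun i =>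
      Fintype.sum_equiv (Equiv.funUnique (Fin 1) ι).symm _ _ fun j => ?_
    simp [evalMat, kronPow, Matrix.vecMulVec_apply]
    ring

end Cone

/-- **Matrix Krivine–Stengle Positivstellensatz.**
Suppose `K = {x : G(x) ⪰ 0}` is compact, `I_q − G(x) ⪰ 0` on `K`, and
`ℝ[x] = H(G) − H(G)`, where `H(G)` consists of the polynomials
`λ₀ + ∑_{k=1}^m ⟨Λ_k, G̃(x)^{⊗k}⟩` with `G̃ = diag(G, I − G)`, `λ₀ ≥ 0` and each `Λ_k`
a `(2q)^k × (2q)^k` positive semidefinite matrix. If `f` is positive on `K`,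
then `f ∈ H(G)`. -/
theorem matrix_krivine_stengle {n q : ℕ}
    (G : Matrix (Fin q) (Fin q) (MvPolynomial (Fin n) ℝ)) (hG : G.IsSymm)
    (K : Set (Fin n → ℝ))
    (hK : K = {x | (evalMat x G).PosSemidef})
    (hcomp : IsCompact K)
    (hIG : ∀ x ∈ K, ((1 : Matrix (Fin q) (Fin q) ℝ) - evalMat x G).PosSemidef)
    (hspan : ∀ p : MvPolynomial (Fin n) ℝ,
      ∃ h1 ∈ Hset (dilate G), ∃ h2 ∈ Hset (dilate G), p = h1 - h2)
    (f : MvPolynomial (Fin n) ℝ)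
    (hf : ∀ x ∈ K, 0 < MvPolynomial.eval x f) :
    f ∈ Hset (dilate G) := by
  have hreal : ∀ r : ℝ, 0 ≤ r →
      algebraMap ℝ (MvPolynomial (Fin n) ℝ) r ∈ HsetSubsemiring (dilate G) :=
    fun r hr => C_mem_Hset hr
  have harch : ∀ p : MvPolynomial (Fin n) ℝ, ∃ N : ℝ,
      algebraMap ℝ (MvPolynomial (Fin n) ℝ) N - p ∈ HsetSubsemiring (dilate G) := by
    intro p
    obtain ⟨h₁, hh₁, h₂, hh₂, rfl⟩ := hspan p
    obtain ⟨N, hN⟩ := exists_C_sub_mem_Hset (trace_dilate G) hh₁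
    refine ⟨N, ?_⟩
    rw [sub_sub_eq_add_sub, add_sub_right_comm]
    exact add_mem_Hset hN hh₂
  by_contra hfH
  obtain ⟨φ, hφ, hφf⟩ := exists_algHom_nonpos_of_notMem hreal harch
    (show f ∉ HsetSubsemiring (dilate G) from hfH)
  have heval : ∀ p, φ p = MvPolynomial.eval (φ ∘ MvPolynomial.X) p := fun p => by
    conv_lhs => rw [MvPolynomial.aeval_unique φ]
    rw [MvPolynomial.aeval_eq_eval]
  have hsymm : (dilate G).IsSymm :=
    Matrix.IsSymm.fromBlocks hG (by simp) (Matrix.isSymm_one.sub hG)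
  have hpsd := posSemidef_evalMat_of_nonneg hsymm (x := φ ∘ MvPolynomial.X)
    fun p hp => heval p ▸ hφ p hp
  have hmem : φ ∘ MvPolynomial.X ∈ K := by
    rw [hK]
    exact hpsd.submatrix Sum.inl
  exact (hf _ hmem).not_ge (heval f ▸ hφf)

end
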